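/- Let C be a C*-category and x ∈ C_{AB} an arrow between two distinct objects A ≠ B. Then the C*-subcategory C(x) generated by x is commutative and full, where C(x)_{AA} is the closed span of {(x∘x*)ⁿ : n ≥ 1}, C(x)_{BB} is the closed span of {(x*∘x)ⁿ : n ≥ 1}, C(x)_{AB} is the closure of x∘C(x)_{BB}, and C(x)_{BA} = C(x)_{AB}*. -/

import Mathlib

open ComplexConjugate

/-- A C*-category: Hom spaces are complex Banach spaces, composition is bilinear and
submultiplicative, and there is an antilinear involutive contravariant *-operation fixing
objects, satisfying the C*-identity and positivity. -/
class CStarCat (O : Type*) (Hom : O → O → Type*)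
    [∀ A B, NormedAddCommGroup (Hom A B)] [∀ A B, NormedSpace ℂ (Hom A B)] where
  complete : ∀ A B, CompleteSpace (Hom A B)
  comp : ∀ {A B C : O}, Hom A B → Hom B C → Hom A C
  ide : ∀ A : O, Hom A A
  comp_assoc : ∀ {A B C D : O} (x : Hom A B) (y : Hom B C) (z : Hom C D),
      comp (comp x y) z = comp x (comp y z)
  ide_comp : ∀ {A B : O} (x : Hom A B), comp (ide A) x = x
  comp_ide : ∀ {A B : O} (x : Hom A B), comp x (ide B) = x
  comp_add_left : ∀ {A B C : O} (x y : Hom A B) (z : Hom B C),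
      comp (x + y) z = comp x z + comp y z
  comp_add_right : ∀ {A B C : O} (x : Hom A B) (y z : Hom B C),
      comp x (y + z) = comp x y + comp x z
  comp_smul_left : ∀ {A B C : O} (c : ℂ) (x : Hom A B) (z : Hom B C),
      comp (c • x) z = c • comp x z
  comp_smul_right : ∀ {A B C : O} (c : ℂ) (x : Hom A B) (z : Hom B C),
      comp x (c • z) = c • comp x z
  norm_comp_le : ∀ {A B C : O} (x : Hom A B) (y : Hom B C), ‖comp x y‖ ≤ ‖x‖ * ‖y‖
  invol : ∀ {A B : O}, Hom A B → Hom B A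
  invol_invol : ∀ {A B : O} (x : Hom A B), invol (invol x) = x
  invol_add : ∀ {A B : O} (x y : Hom A B), invol (x + y) = invol x + invol y
  invol_smul : ∀ {A B : O} (c : ℂ) (x : Hom A B), invol (c • x) = (conj c) • invol x
  invol_comp : ∀ {A B C : O} (x : Hom A B) (y : Hom B C),
      invol (comp x y) = comp (invol y) (invol x)
  norm_invol_comp : ∀ {A B : O} (x : Hom A B), ‖comp (invol x) x‖ = ‖x‖ ^ 2
  pos : ∀ {A B : O} (x : Hom A B), ∃ y : Hom B B, comp (invol x) x = comp (invol y) y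

variable {O : Type*} {Hom : O → O → Type*}
  [∀ A B, NormedAddCommGroup (Hom A B)] [∀ A B, NormedSpace ℂ (Hom A B)]
  [CStarCat O Hom]

/-- The powers (x∘x*)ⁿ⁺¹ in Hom A A. -/
def powAA {A B : O} (x : Hom A B) : ℕ → Hom A A
  | 0 => CStarCat.comp x (CStarCat.invol x)
  | n + 1 => CStarCat.comp (powAA x n) (CStarCat.comp x (CStarCat.invol x))

/-- The powers (x*∘x)ⁿ⁺¹ in Hom B B. -/
def powBB {A B : O} (x : Hom A B) : ℕ → Hom B B
  | 0 => CStarCat.comp (CStarCat.invol x) x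
  | n + 1 => CStarCat.comp (powBB x n) (CStarCat.comp (CStarCat.invol x) x)

/-- C(x)_{AA}: the closed span of the powers (x∘x*)ⁿ, n ≥ 1. -/
def genAA {A B : O} (x : Hom A B) : Set (Hom A A) :=
  closure ((Submodule.span ℂ (Set.range (powAA x)) : Submodule ℂ (Hom A A)) :
    Set (Hom A A))

/-- C(x)_{BB}: the closed span of the powers (x*∘x)ⁿ, n ≥ 1. -/
def genBB {A B : O} (x : Hom A B) : Set (Hom B B) :=
  closure ((Submodule.span ℂ (Set.range (powBB x)) : Submodule ℂ (Hom B B)) :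
    Set (Hom B B))

/-- C(x)_{AB}: the closure of x ∘ C(x)_{BB}. -/
def genAB {A B : O} (x : Hom A B) : Set (Hom A B) :=
  closure {z : Hom A B | ∃ b ∈ genBB x, z = CStarCat.comp x b}

/-- C(x)_{BA} := C(x)_{AB}*. -/
def genBA {A B : O} (x : Hom A B) : Set (Hom B A) :=
  CStarCat.invol '' genAB x

section CStarAlgebra

variable {E : Type*} [CStarAlgebra E]

theorem NonUnitalStarAlgebra.coe_elemental_eq_closure_span_pow {h : E} (hh : IsSelfAdjoint h) :
    (NonUnitalStarAlgebra.elemental ℂ h : Set E) =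
      closure (Submodule.span ℂ (Set.range fun n : ℕ => h ^ (n + 1)) : Set E) := by
  have key : (NonUnitalStarAlgebra.adjoin ℂ {h} : Set E) =
      (Submodule.span ℂ (Set.range fun n : ℕ => h ^ (n + 1)) : Set E) := by
    apply Set.Subset.antisymm
    · intro z hz
      induction hz using NonUnitalStarAlgebra.adjoin_induction with
      | mem y hy =>
        rw [Set.mem_singleton_iff.1 hy]
        exact Submodule.subset_span ⟨0, by simp⟩
      | add y z _ _ hy hz => exact Submodule.add_mem _ hy hz
      | zero => exact Submodule.zero_mem _
      | smul c y _ hy => exact Submodule.smul_mem _ c hy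
      | mul y z _ _ hy hz =>
        have hyz := Submodule.mul_mem_mul hy hz
        rw [Submodule.span_mul_span] at hyz
        refine Submodule.span_mono ?_ hyz
        rintro _ ⟨_, ⟨m, rfl⟩, _, ⟨n, rfl⟩, rfl⟩
        exact ⟨m + n + 1, by simp only [← pow_add]; congr 1; ring⟩
      | star y hy' hy =>
        clear hy'
        induction hy using Submodule.span_induction with
        | mem y hy =>
          obtain ⟨n, rfl⟩ := hy
          exact Submodule.subset_span ⟨n, by simp [hh.star_eq]⟩
        | zero => simp
        | add y z _ _ hy hz => rw [star_add]; exact Submodule.add_mem _ hy hz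
        | smul c y _ hy => rw [star_smul]; exact Submodule.smul_mem _ _ hy
    · have hle : Submodule.span ℂ (Set.range fun n : ℕ => h ^ (n + 1)) ≤
          (NonUnitalStarAlgebra.adjoin ℂ {h}).toSubmodule := by
        rw [Submodule.span_le]
        rintro _ ⟨n, rfl⟩
        have hmem : h ∈ NonUnitalStarAlgebra.adjoin ℂ {h} :=
          NonUnitalStarAlgebra.self_mem_adjoin_singleton ℂ h
        induction n with
        | zero => simp [hmem]
        | succ n ih =>
          simp only [pow_succ _ (n + 1)]
          exact mul_mem (S := NonUnitalStarSubalgebra ℂ E) ih hmem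
      exact hle
  rw [← key]
  rfl

theorem abs_mul_one_sub_sq_pow_le {R t : ℝ} (hR : 0 < R) (ht : |t| ≤ R) {N : ℕ} (hN : 0 < N) :
    |t * (1 - (R⁻¹ * t) ^ 2) ^ (2 * N ^ 2)| ≤ R / N := by
  obtain ⟨s, rfl⟩ : ∃ s, t = R * s := ⟨R⁻¹ * t, by field_simp⟩
  rw [inv_mul_cancel_left₀ hR.ne', abs_mul, abs_mul, abs_of_pos hR, mul_assoc, div_eq_mul_inv]
  rw [abs_mul, abs_of_pos hR] at ht
  have hs : |s| ≤ 1 := by nlinarith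
  have hs2 : s ^ 2 ≤ 1 := by rw [← sq_abs]; nlinarith [abs_nonneg s]
  have hN' : (0 : ℝ) < N := by exact_mod_cast hN
  gcongr
  rw [abs_of_nonneg (pow_nonneg (sub_nonneg.2 hs2) _)]
  set p := (1 - s ^ 2) ^ (2 * N ^ 2) with hp
  have hp0 : 0 ≤ p := pow_nonneg (by linarith) _
  have hbern : p * (1 + 2 * N ^ 2 * s ^ 2) ≤ 1 := by
    calc p * (1 + 2 * N ^ 2 * s ^ 2) ≤ p * (1 + s ^ 2) ^ (2 * N ^ 2) := by
          gcongr
          have := one_add_mul_le_pow (a := s ^ 2) (by nlinarith [sq_nonneg s]) (2 * N ^ 2)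
          push_cast at this
          exact this
      _ = (1 - (s ^ 2) ^ 2) ^ (2 * N ^ 2) := by rw [hp, ← mul_pow]; congr 1; ring
      _ ≤ 1 := pow_le_one₀ (by nlinarith [sq_nonneg s]) (by nlinarith [sq_nonneg (s ^ 2)])
  have hsN : |s| * N ≤ 1 + 2 * N ^ 2 * s ^ 2 := by
    rw [← sq_abs s]
    nlinarith [sq_nonneg (|s| * N - 1), sq_nonneg (|s| * N)]
  rw [← one_div, le_div_iff₀ hN']
  nlinarith [mul_le_mul_of_nonneg_left hsN hp0]

/-- The non-unital star algebra generated by a self-adjoint `h` contains approximate right units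
for every `x` with `star x * x = h`. -/
theorem IsSelfAdjoint.exists_norm_star_one_sub_mul_mul_lt {h : E} (hh : IsSelfAdjoint h)
    {ε : ℝ} (hε : 0 < ε) :
    ∃ b ∈ NonUnitalStarAlgebra.elemental ℂ h, ‖star (1 - b) * h * (1 - b)‖ < ε := by
  set R : ℝ := ‖h‖ + 1
  have hR : 0 < R := by positivity
  obtain ⟨N, hN⟩ := exists_nat_gt (R / ε)
  have hN' : (0 : ℝ) < N := (by positivity : 0 < R / ε).trans hN
  set k : E := (R⁻¹ • h) ^ 2 with hk
  have hmem : h ∈ NonUnitalStarAlgebra.elemental ℂ h :=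
    NonUnitalStarAlgebra.elemental.self_mem ℂ h
  have hk_mem : k ∈ NonUnitalStarAlgebra.elemental ℂ h := by
    have : k = ((R⁻¹ ^ 2 : ℝ) : ℂ) • (h * h) := by
      rw [hk, smul_pow, sq h, Complex.coe_smul]
    rw [this]
    exact SMulMemClass.smul_mem _ (mul_mem hmem hmem)
  have hpow (n : ℕ) : 1 - (1 - k) ^ n ∈ NonUnitalStarAlgebra.elemental ℂ h := by
    induction n with
    | zero => simp
    | succ n ih =>
      have : 1 - (1 - k) ^ (n + 1) = (1 - (1 - k) ^ n) - (1 - (1 - k) ^ n) * k + k := by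
        rw [pow_succ]; noncomm_ring
      rw [this]
      exact add_mem (sub_mem ih (mul_mem ih hk_mem)) hk_mem
  refine ⟨_, hpow (N ^ 2), ?_⟩
  have hk_sa : IsSelfAdjoint (1 - k) :=
    (IsSelfAdjoint.one E).sub (((IsSelfAdjoint.all R⁻¹).smul hh).pow 2)
  have hcomm : Commute ((1 - k) ^ N ^ 2) h := by
    refine ((Commute.one_left h).sub_left ?_).pow_left _
    exact ((Commute.refl h).smul_left _).pow_left _
  have hcfc : h * (1 - k) ^ (2 * N ^ 2) =
      cfc (fun t : ℝ => t * (1 - (R⁻¹ * t) ^ 2) ^ (2 * N ^ 2)) h := by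
    rw [cfc_mul (fun t : ℝ => t) (fun t : ℝ => (1 - (R⁻¹ * t) ^ 2) ^ (2 * N ^ 2)) h,
      cfc_pow (fun t : ℝ => 1 - (R⁻¹ * t) ^ 2) _ h,
      cfc_sub (fun _ : ℝ => 1) (fun t : ℝ => (R⁻¹ * t) ^ 2) h,
      cfc_pow (fun t : ℝ => R⁻¹ * t) _ h, cfc_const_mul_id R⁻¹ h, cfc_id' ℝ h,
      cfc_const_one ℝ h]
  rw [sub_sub_cancel, (hk_sa.pow _).star_eq, hcomm.eq, mul_assoc, ← pow_add, ← two_mul, hcfc]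
  refine (norm_cfc_le (by positivity) fun t ht => ?_).trans_lt
    ((div_lt_comm₀ hε hN').1 hN)
  refine abs_mul_one_sub_sq_pow_le hR ?_ (by exact_mod_cast hN')
  have := spectrum.norm_le_norm_mul_of_mem ht
  have h1 : ‖(1 : E)‖ ≤ 1 := by
    rcases subsingleton_or_nontrivial E with _ | _
    · simp [Subsingleton.elim (1 : E) 0]
    · simp
  rw [Real.norm_eq_abs] at this
  nlinarith [norm_nonneg h]

end CStarAlgebra

namespace CStarCat

@[simp]
theorem norm_invol {A B : O} (x : Hom A B) : ‖invol x‖ = ‖x‖ := by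
  have hle {A B : O} (x : Hom A B) : ‖x‖ ≤ ‖invol x‖ := by
    rcases eq_or_ne x 0 with rfl | hx
    · simp
    · have h := norm_comp_le (invol x) x
      rw [norm_invol_comp, sq] at h
      exact le_of_mul_le_mul_right h (norm_pos_iff.2 hx)
  exact le_antisymm (by simpa only [invol_invol] using hle (invol x)) (hle x)

/-- The involution as an additive map. -/
def involHom (A B : O) : Hom A B →+ Hom B A := AddMonoidHom.mk' invol invol_add

theorem continuous_invol {A B : O} : Continuous (invol : Hom A B → Hom B A) :=
  AddMonoidHomClass.continuous_of_bound (involHom A B) 1 fun x => by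
    simp [involHom]

/-- Composition as a bounded bilinear map. -/
noncomputable def compL (A B C : O) : Hom A B →L[ℂ] Hom B C →L[ℂ] Hom A C :=
  LinearMap.mkContinuous₂
    (LinearMap.mk₂ ℂ comp comp_add_left comp_smul_left comp_add_right comp_smul_right) 1
    fun x y => by simpa using norm_comp_le x y

theorem continuous_comp_uncurry {A B C : O} :
    Continuous fun p : Hom A B × Hom B C => comp p.1 p.2 :=
  (compL A B C).continuous₂

theorem comp_sub_right {A B C : O} (x : Hom A B) (y z : Hom B C) :
    comp x (y - z) = comp x y - comp x z :=
  map_sub (compL A B C x) y z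

/-- The endomorphism spaces of a C*-category are unital C*-algebras. -/
noncomputable abbrev endCStarAlgebra (B : O) : CStarAlgebra (Hom B B) :=
  letI ring : NormedRing (Hom B B) :=
    { (inferInstance : NormedAddCommGroup (Hom B B)) with
      mul := comp
      one := ide B
      mul_assoc := comp_assoc
      one_mul := ide_comp
      mul_one := comp_ide
      left_distrib := comp_add_right
      right_distrib := comp_add_left
      zero_mul := fun y => map_zero ((compL B B B).flip y)
      mul_zero := fun y => map_zero (compL B B B y)
      norm_mul_le := norm_comp_le }
  letI alg : NormedAlgebra ℂ (Hom B B) :=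
    { Algebra.ofModule (R := ℂ) (A := Hom B B) comp_smul_left
        (fun c x y => comp_smul_right c x y) with
      norm_smul_le := norm_smul_le }
  letI starRing : StarRing (Hom B B) :=
    { star := invol
      star_involutive := invol_invol
      star_mul := invol_comp
      star_add := invol_add }
  { ring, alg, starRing with
    complete := (complete B B).complete
    norm_mul_self_le := fun x => by
      have h : ‖comp (invol x) x‖ = ‖x‖ ^ 2 := norm_invol_comp x
      exact (sq ‖x‖ ▸ h).ge
    star_smul := invol_smul }

theorem invol_comp_self {A B : O} (x : Hom A B) :
    invol (comp (invol x) x) = comp (invol x) x := by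
  rw [invol_comp, invol_invol]

theorem genBB_eq_elemental {A B : O} (x : Hom A B) :
    letI := endCStarAlgebra (Hom := Hom) B
    genBB x = (NonUnitalStarAlgebra.elemental ℂ (comp (invol x) x) : Set (Hom B B)) := by
  let := endCStarAlgebra (Hom := Hom) B
  have hpow : powBB x = fun n => (comp (invol x) x) ^ (n + 1) := by
    funext n
    induction n with
    | zero => exact (pow_one _).symm
    | succ n ih =>
      rw [pow_succ, ← ih]
      rfl
  rw [NonUnitalStarAlgebra.coe_elemental_eq_closure_span_pow (invol_comp_self x), ← hpow]
  rfl

theorem comp_mem_genBB {A B : O} {x : Hom A B} {b c : Hom B B} (hb : b ∈ genBB x)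
    (hc : c ∈ genBB x) : comp b c ∈ genBB x := by
  let := endCStarAlgebra (Hom := Hom) B
  rw [genBB_eq_elemental] at *
  exact mul_mem (S := NonUnitalStarSubalgebra ℂ (Hom B B)) hb hc

theorem invol_mem_genBB {A B : O} {x : Hom A B} {b : Hom B B} (hb : b ∈ genBB x) :
    invol b ∈ genBB x := by
  let := endCStarAlgebra (Hom := Hom) B
  rw [genBB_eq_elemental] at *
  exact star_mem (S := NonUnitalStarSubalgebra ℂ (Hom B B)) hb

theorem comp_comm_of_mem_genBB {A B : O} {x : Hom A B} {b c : Hom B B} (hb : b ∈ genBB x)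
    (hc : c ∈ genBB x) : comp b c = comp c b := by
  let := endCStarAlgebra (Hom := Hom) B
  rw [genBB_eq_elemental] at hb hc
  have : IsStarNormal (comp (invol x) x) := IsSelfAdjoint.isStarNormal (invol_comp_self x)
  exact congrArg Subtype.val (mul_comm
    (⟨b, hb⟩ : NonUnitalStarAlgebra.elemental ℂ (comp (invol x) x)) ⟨c, hc⟩)

theorem powBB_mem_genBB {A B : O} (x : Hom A B) (n : ℕ) : powBB x n ∈ genBB x :=
  subset_closure (Submodule.subset_span ⟨n, rfl⟩)

theorem powAA_eq_powBB_invol {A B : O} (x : Hom A B) : powAA x = powBB (invol x) := by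
  funext n
  induction n with
  | zero => simp only [powAA, powBB, invol_invol]
  | succ n ih => simp only [powAA, powBB, invol_invol, ih]

theorem genAA_eq_genBB_invol {A B : O} (x : Hom A B) : genAA x = genBB (invol x) := by
  simp only [genAA, genBB, powAA_eq_powBB_invol]

theorem powAA_succ {A B : O} (x : Hom A B) (n : ℕ) :
    powAA x (n + 1) = comp (comp x (powBB x n)) (invol x) := by
  induction n with
  | zero => simp only [powAA, powBB, comp_assoc]
  | succ n ih => rw [powAA, ih]; simp only [powBB, comp_assoc]

theorem powBB_succ {A B : O} (x : Hom A B) (n : ℕ) :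
    powBB x (n + 1) = comp (invol x) (comp x (powBB x n)) := by
  rw [← comp_assoc]
  exact comp_comm_of_mem_genBB (powBB_mem_genBB x n) (powBB_mem_genBB x 0)

theorem comp_comp_invol_mem_genAA {A B : O} {x : Hom A B} {b : Hom B B} (hb : b ∈ genBB x) :
    comp (comp x b) (invol x) ∈ genAA x := by
  set f : Hom B B →L[ℂ] Hom A A := ((compL A B A).flip (invol x)).comp (compL A B B x)
  refine map_mem_closure (f := f) f.continuous hb fun c hc => ?_
  refine (Submodule.span_le (p := (Submodule.span ℂ (Set.range (powAA x))).comap f.toLinearMap)).2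
    ?_ hc
  rintro _ ⟨n, rfl⟩
  exact Submodule.subset_span ⟨n + 1, powAA_succ x n⟩

/-- The generator belongs to the off-diagonal block it generates. -/
theorem self_mem_genAB {A B : O} (x : Hom A B) : x ∈ genAB x := by
  let := endCStarAlgebra (Hom := Hom) B
  refine Metric.mem_closure_iff.2 fun ε hε => ?_
  obtain ⟨b, hb, hlt⟩ := IsSelfAdjoint.exists_norm_star_one_sub_mul_mul_lt
    (h := comp (invol x) x) (invol_comp_self x) (pow_pos hε 2)
  refine ⟨comp x b, ⟨b, by rwa [genBB_eq_elemental], rfl⟩, ?_⟩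
  have hsub : x - comp x b = comp x (ide B - b) := by rw [comp_sub_right, comp_ide]
  have hnorm : ‖x - comp x b‖ ^ 2 < ε ^ 2 := by
    rw [hsub, ← norm_invol_comp, invol_comp, comp_assoc, ← comp_assoc (invol x), ← comp_assoc]
    exact hlt
  rw [dist_eq_norm]
  exact lt_of_pow_lt_pow_left₀ 2 hε.le hnorm

theorem comp_powBB_mem_genAB {A B : O} (x : Hom A B) (n : ℕ) :
    comp x (powBB x n) ∈ genAB x :=
  subset_closure ⟨_, powBB_mem_genBB x n, rfl⟩

theorem comp_invol_mem_genAA {A B : O} {x u w : Hom A B} (hu : u ∈ genAB x) (hw : w ∈ genAB x) :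
    comp u (invol w) ∈ genAA x := by
  have hcont : Continuous fun p : Hom A B × Hom A B => comp p.1 (invol p.2) :=
    continuous_comp_uncurry.comp (continuous_fst.prodMk (continuous_invol.comp continuous_snd))
  have := map_mem_closure₂ (u := genAA x) (f := fun a b => comp a (invol b)) hcont hu hw ?_
  · rwa [genAA, closure_closure] at this
  rintro _ ⟨b, hb, rfl⟩ _ ⟨c, hc, rfl⟩
  have := comp_comp_invol_mem_genAA (comp_mem_genBB hb (invol_mem_genBB hc))
  simpa only [invol_comp, comp_assoc] using this

theorem invol_comp_mem_genBB {A B : O} {x u w : Hom A B} (hu : u ∈ genAB x) (hw : w ∈ genAB x) :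
    comp (invol w) u ∈ genBB x := by
  have hcont : Continuous fun p : Hom A B × Hom A B => comp (invol p.2) p.1 :=
    continuous_comp_uncurry.comp ((continuous_invol.comp continuous_snd).prodMk continuous_fst)
  have := map_mem_closure₂ (u := genBB x) (f := fun a b => comp (invol b) a) hcont hu hw ?_
  · rwa [genBB, closure_closure] at this
  rintro _ ⟨b, hb, rfl⟩ _ ⟨c, hc, rfl⟩
  have := comp_mem_genBB (invol_mem_genBB hc) (comp_mem_genBB (powBB_mem_genBB x 0) hb)
  simpa only [powBB, invol_comp, comp_assoc] using this

end CStarCat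

open CStarCat in
/-- For an arrow x ∈ C_{AB} between two distinct objects A ≠ B of a
C*-category, the C*-subcategory C(x) generated by x is commutative (its diagonal blocks
are commutative) and full (the spans of the products C(x)_{AB}∘C(x)_{BA} and
C(x)_{BA}∘C(x)_{AB} are dense in C(x)_{AA} and C(x)_{BB} respectively). -/
theorem generated_subcategory_commutative_full
    {A B : O} (hAB : A ≠ B) (x : Hom A B) :
    (∀ a ∈ genAA x, ∀ b ∈ genAA x, CStarCat.comp a b = CStarCat.comp b a) ∧
    (∀ a ∈ genBB x, ∀ b ∈ genBB x, CStarCat.comp a b = CStarCat.comp b a) ∧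
    closure ((Submodule.span ℂ
      {z : Hom A A | ∃ u ∈ genAB x, ∃ v ∈ genBA x, z = CStarCat.comp u v} :
        Submodule ℂ (Hom A A)) : Set (Hom A A)) = genAA x ∧
    closure ((Submodule.span ℂ
      {z : Hom B B | ∃ v ∈ genBA x, ∃ u ∈ genAB x, z = CStarCat.comp v u} :
        Submodule ℂ (Hom B B)) : Set (Hom B B)) = genBB x := by
  refine ⟨fun a ha b hb => ?_, fun a ha b hb => comp_comm_of_mem_genBB ha hb, ?_, ?_⟩
  · rw [genAA_eq_genBB_invol] at ha hb
    exact comp_comm_of_mem_genBB ha hb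
  · apply Set.Subset.antisymm
    · refine closure_minimal ?_ isClosed_closure
      refine Submodule.span_le (p := (Submodule.span ℂ (Set.range (powAA x))).topologicalClosure).2
        ?_
      rintro _ ⟨u, hu, _, ⟨w, hw, rfl⟩, rfl⟩
      exact comp_invol_mem_genAA hu hw
    · refine closure_mono (Submodule.span_mono ?_)
      rintro _ ⟨n, rfl⟩
      have hx : invol x ∈ genBA x := ⟨x, self_mem_genAB x, rfl⟩
      cases n with
      | zero => exact ⟨x, self_mem_genAB x, _, hx, rfl⟩
      | succ n => exact ⟨_, comp_powBB_mem_genAB x n, _, hx, powAA_succ x n⟩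
  · apply Set.Subset.antisymm
    · refine closure_minimal ?_ isClosed_closure
      refine Submodule.span_le (p := (Submodule.span ℂ (Set.range (powBB x))).topologicalClosure).2
        ?_
      rintro _ ⟨_, ⟨w, hw, rfl⟩, u, hu, rfl⟩
      exact invol_comp_mem_genBB hu hw
    · refine closure_mono (Submodule.span_mono ?_)
      rintro _ ⟨n, rfl⟩
      have hx : invol x ∈ genBA x := ⟨x, self_mem_genAB x, rfl⟩
      cases n with
      | zero => exact ⟨_, hx, x, self_mem_genAB x, rfl⟩
      | succ n => exact ⟨_, hx, _, comp_powBB_mem_genAB x n, powBB_succ x n⟩
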